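/- For every unitary 4×4 complex matrix U (indexed by Fin 2 × Fin 2, viewed as acting on ℂ²⊗ℂ²), there exist 2×2 unitary complex matrices A, B, C, D and real numbers αx, αy, αz with π/2 ≥ αx ≥ αy ≥ |αz| ≥ 0 such that U = (A ⊗ B) · exp(−(i/2)(αx·σx⊗σx + αy·σy⊗σy + αz·σz⊗σz)) · (C ⊗ D), where ⊗ denotes the Kronecker product of matrices and exp is the matrix exponential. -/

import Mathlib

open Matrix Kronecker Complex

noncomputable def σx : Matrix (Fin 2) (Fin 2) ℂ := !![0, 1; 1, 0]
noncomputable def σy : Matrix (Fin 2) (Fin 2) ℂ := !![0, -I; I, 0]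
noncomputable def σz : Matrix (Fin 2) (Fin 2) ℂ := !![1, 0; 0, -1]

theorem kc_simdiag {n : Type} [Fintype n] [DecidableEq n] (X Y : Matrix n n ℝ)
    (hX : Xᵀ = X) (hY : Yᵀ = Y) (hXY : X * Y = Y * X) :
    ∃ (P : Matrix n n ℝ) (x y : n → ℝ), Pᵀ * P = 1 ∧ X * P = P * diagonal x ∧
      Y * P = P * diagonal y := by
  classical
  have hA : (Matrix.toEuclideanLin X).IsSymmetric :=
    Matrix.isSymmetric_toEuclideanLin_iff.mpr (by simpa [Matrix.IsHermitian] using hX)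
  have hB : (Matrix.toEuclideanLin Y).IsSymmetric :=
    Matrix.isSymmetric_toEuclideanLin_iff.mpr (by simpa [Matrix.IsHermitian] using hY)
  have hc : Commute (Matrix.toEuclideanLin X) (Matrix.toEuclideanLin Y) := by
    apply LinearMap.ext
    intro v
    simp [Matrix.toLpLin_apply, hXY]
  have hI := LinearMap.IsSymmetric.directSum_isInternal_of_commute hA hB hc
  have hO := LinearMap.IsSymmetric.orthogonalFamily_eigenspace_inf_eigenspace hA hB
  have hfin := WellFoundedGT.finite_ne_bot_of_iSupIndep hI.submodule_iSupIndep
  have hI' := DirectSum.isInternal_ne_bot_iff.mpr hI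
  let _ : Fintype {i : ℝ × ℝ // (Module.End.eigenspace (Matrix.toEuclideanLin X) i.2 ⊓
      Module.End.eigenspace (Matrix.toEuclideanLin Y) i.1) ≠ ⊥} := hfin.fintype
  have hO' := hO.comp (Subtype.val_injective (p := fun i : ℝ × ℝ =>
    (Module.End.eigenspace (Matrix.toEuclideanLin X) i.2 ⊓
      Module.End.eigenspace (Matrix.toEuclideanLin Y) i.1) ≠ ⊥))
  have hn : Module.finrank ℝ (EuclideanSpace ℝ n) = Fintype.card n := by simp
  let b := (hI'.subordinateOrthonormalBasis hn hO').reindex (Fintype.equivFin n).symm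
  let ix : n → ℝ × ℝ := fun k =>
    (hI'.subordinateOrthonormalBasisIndex hn (Fintype.equivFin n k) hO').1
  have hb : ∀ k, b k ∈ Module.End.eigenspace (Matrix.toEuclideanLin X) (ix k).2 ⊓
      Module.End.eigenspace (Matrix.toEuclideanLin Y) (ix k).1 := by
    intro k
    have := hI'.subordinateOrthonormalBasis_subordinate hn (Fintype.equivFin n k) hO'
    simpa [b, ix] using this
  refine ⟨Matrix.of fun i j => b j i, fun k => (ix k).2, fun k => (ix k).1, ?_, ?_, ?_⟩
  · ext i j
    have := orthonormal_iff_ite.mp b.orthonormal i j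
    simp only [PiLp.inner_apply] at this
    simp only [Matrix.mul_apply, Matrix.one_apply, Matrix.transpose_apply, Matrix.of_apply]
    rw [← this]
    simp [mul_comm]
  · ext i j
    have := Module.End.mem_eigenspace_iff.mp (hb j).1
    have := congrArg (fun v : EuclideanSpace ℝ n => v i) this
    rw [Matrix.mul_diagonal]
    simpa [Matrix.toLpLin_apply, Matrix.mulVec, dotProduct, Matrix.mul_apply,
      mul_comm] using this
  · ext i j
    have := Module.End.mem_eigenspace_iff.mp (hb j).2
    have := congrArg (fun v : EuclideanSpace ℝ n => v i) this
    rw [Matrix.mul_diagonal]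
    simpa [Matrix.toLpLin_apply, Matrix.mulVec, dotProduct, Matrix.mul_apply,
      mul_comm] using this
theorem kc_cartan {n : Type} [Fintype n] [DecidableEq n] (p : Matrix n n ℝ → Prop)
    (h1 : p 1) (hr : ∀ (u : n → ℝ) (M : Matrix n n ℝ), ∑ i, u i ^ 2 = 1 → p M →
      p ((1 - (2:ℝ) • Matrix.vecMulVec u u) * M))
    (K : Matrix n n ℝ) (hK : Kᵀ * K = 1) : p K := by
  classical
  let f : EuclideanSpace ℝ n →ₗᵢ[ℝ] EuclideanSpace ℝ n :=
    (Matrix.toEuclideanLin K).isometryOfInner (by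
      intro x y
      have : (K *ᵥ y.ofLp) ⬝ᵥ (K *ᵥ x.ofLp) = y.ofLp ⬝ᵥ x.ofLp := by
        rw [Matrix.dotProduct_mulVec, Matrix.vecMul_mulVec, hK, Matrix.vecMul_one]
      simpa [EuclideanSpace.inner_eq_star_dotProduct, Matrix.toLpLin_apply] using this)
  let φ : EuclideanSpace ℝ n ≃ₗᵢ[ℝ] EuclideanSpace ℝ n := f.toLinearIsometryEquiv rfl
  let mat : (EuclideanSpace ℝ n ≃ₗᵢ[ℝ] EuclideanSpace ℝ n) → Matrix n n ℝ := fun g =>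
    Matrix.toEuclideanLin.symm g.toLinearEquiv.toLinearMap
  have hφ : mat φ = K := by
    simp only [mat]
    rw [LinearEquiv.symm_apply_eq]
    ext x
    rfl
  have key : ∀ l : List (EuclideanSpace ℝ n),
      p (mat (l.map fun v => Submodule.reflection (ℝ ∙ v)ᗮ).prod) := by
    intro l
    induction l with
    | nil =>
      have : mat 1 = 1 := by
        simp only [mat]
        rw [LinearEquiv.symm_apply_eq]
        apply LinearMap.ext
        intro x
        simp [Matrix.toLpLin_apply]
      simpa [this] using h1
    | cons v l ih =>
      rw [List.map_cons, List.prod_cons]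
      set g := (l.map fun v => Submodule.reflection (ℝ ∙ v)ᗮ).prod with hg
      by_cases hv : v = 0
      · have : Submodule.reflection (ℝ ∙ v)ᗮ * g = g := by
          ext x
          rw [LinearIsometryEquiv.coe_mul, Function.comp_apply, Submodule.reflection_orthogonal_apply,
            Submodule.reflection_singleton_apply]
          simp [hv]
        rw [this]; exact ih
      · have hvn : ‖v‖ ≠ 0 := by simpa using hv
        have hvs : ∑ i, v i ^ 2 = ‖v‖ ^ 2 := by
          rw [EuclideanSpace.norm_sq_eq]; simp
        have := hr (fun i => v i / ‖v‖) (mat g) (by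
          simp only [div_pow]
          rw [← Finset.sum_div, hvs]
          field_simp) ih
        convert this using 1
        simp only [mat]
        rw [LinearEquiv.symm_apply_eq]
        apply LinearMap.ext
        intro x
        have hx : Matrix.toEuclideanLin (mat g) x = g x := by simp [mat]
        have hx' : (mat g) *ᵥ x.ofLp = (g x).ofLp := by rw [← hx]; rfl
        apply PiLp.ext
        intro i
        change ((Submodule.reflection (ℝ ∙ v)ᗮ) (g x)) i =
          (((1 - (2:ℝ) • Matrix.vecMulVec (fun i => v i / ‖v‖) (fun i => v i / ‖v‖)) * mat g)
            *ᵥ x.ofLp) i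
        rw [← Matrix.mulVec_mulVec, hx', Submodule.reflection_orthogonal_apply,
          Submodule.reflection_singleton_apply, Matrix.sub_mulVec, Matrix.smul_mulVec,
          Matrix.vecMulVec_mulVec]
        have hin : (fun i => v i / ‖v‖) ⬝ᵥ (g x).ofLp = inner ℝ v (g x) / ‖v‖ := by
          simp only [dotProduct, PiLp.inner_apply, Finset.sum_div]
          refine Finset.sum_congr rfl fun i _ => ?_
          simp; ring
        rw [hin]
        simp
        field_simp
        try ring
  obtain ⟨l, -, hl⟩ := φ.reflections_generate_dim
  have := key l
  rw [← hl, hφ] at this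
  exact this
abbrev M4 := Matrix (Fin 2 × Fin 2) (Fin 2 × Fin 2) ℂ

/-- Unnormalised magic basis. -/
noncomputable def Qm : M4 := Matrix.of fun p q =>
  ![![![![1, I], ![0, 0]], ![![0, 0], ![I, 1]]],
    ![![![0, 0], ![I, -1]], ![![1, -I], ![0, 0]]]] p.1 p.2 q.1 q.2

noncomputable def Sw : M4 := Matrix.of fun p q => if p.1 = q.2 ∧ p.2 = q.1 then 1 else 0

/-- Quaternion matrix. -/
noncomputable def mu (u : Fin 2 × Fin 2 → ℝ) : Matrix (Fin 2) (Fin 2) ℂ :=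
  !![u (0,0) + I * u (0,1), I * u (1,0) + u (1,1); I * u (1,0) - u (1,1), u (0,0) - I * u (0,1)]

theorem mu_unitary (u : Fin 2 × Fin 2 → ℝ) (hu : ∑ i, u i ^ 2 = 1) :
    mu u ∈ Matrix.unitaryGroup (Fin 2) ℂ := by
  have hu' : ((u (0,0):ℂ))^2 + (u (0,1):ℂ)^2 + ((u (1,0):ℂ)^2 + (u (1,1):ℂ)^2) = 1 := by
    rw [Fintype.sum_prod_type] at hu
    simp only [Fin.sum_univ_two] at hu
    exact_mod_cast hu
  rw [Matrix.mem_unitaryGroup_iff]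
  ext i j
  fin_cases i <;> fin_cases j <;>
    simp [mu, Matrix.mul_apply, Fin.sum_univ_two, Matrix.star_apply] <;>
    ring_nf <;> simp only [I_sq] <;> (try linear_combination hu')

theorem sx_unitary : σx ∈ Matrix.unitaryGroup (Fin 2) ℂ := by
  rw [Matrix.mem_unitaryGroup_iff]
  ext i j
  fin_cases i <;> fin_cases j <;> simp [σx, Matrix.mul_apply, Fin.sum_univ_two, Matrix.star_apply]
theorem sy_unitary : σy ∈ Matrix.unitaryGroup (Fin 2) ℂ := by
  rw [Matrix.mem_unitaryGroup_iff]
  ext i j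
  fin_cases i <;> fin_cases j <;> simp [σy, Matrix.mul_apply, Fin.sum_univ_two, Matrix.star_apply]
theorem sz_unitary : σz ∈ Matrix.unitaryGroup (Fin 2) ℂ := by
  rw [Matrix.mem_unitaryGroup_iff]
  ext i j
  fin_cases i <;> fin_cases j <;> simp [σz, Matrix.mul_apply, Fin.sum_univ_two, Matrix.star_apply]

theorem refl_local (u : Fin 2 × Fin 2 → ℝ) (hu : ∑ i, u i ^ 2 = 1) :
    Qm * (1 - (2:ℝ) • Matrix.vecMulVec u u).map (fun r : ℝ => (r : ℂ)) =
      ((-(mu u * σy)) ⊗ₖ (σy * mu u)ᵀ) * Sw * Qm := by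
  have hu' : ((u (0,0):ℂ))^2 + (u (0,1):ℂ)^2 + ((u (1,0):ℂ)^2 + (u (1,1):ℂ)^2) = 1 := by
    rw [Fintype.sum_prod_type] at hu
    simp only [Fin.sum_univ_two] at hu
    exact_mod_cast hu
  have e : (1 - (2:ℝ) • Matrix.vecMulVec u u).map (fun r : ℝ => (r : ℂ)) =
      (((u (0,0):ℂ))^2 + (u (0,1):ℂ)^2 + ((u (1,0):ℂ)^2 + (u (1,1):ℂ)^2)) • (1 : M4)
       - (2:ℂ) • Matrix.vecMulVec (fun i => (u i : ℂ)) (fun i => (u i : ℂ)) := by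
    rw [hu']
    ext i j
    by_cases h : i = j <;> simp [Matrix.vecMulVec_apply, h, Matrix.one_apply]
  rw [e]
  ext ⟨i, j⟩ ⟨k, l⟩
  fin_cases i <;> fin_cases j <;> fin_cases k <;> fin_cases l <;>
    simp [Qm, Sw, mu, σy, Matrix.mul_apply, Fintype.sum_prod_type, Fin.sum_univ_two,
      Matrix.vecMulVec_apply, Matrix.one_apply, Matrix.kroneckerMap_apply] <;>
    ring_nf <;> simp only [I_sq, show I^3 = -I from by rw [pow_succ, I_sq]; ring, I_pow_four,
      show I^5 = I from by rw [pow_succ, I_pow_four, one_mul]] <;>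
    ring

theorem sw_kron (A B : Matrix (Fin 2) (Fin 2) ℂ) : Sw * (A ⊗ₖ B) = (B ⊗ₖ A) * Sw := by
  ext ⟨i, j⟩ ⟨k, l⟩
  fin_cases i <;> fin_cases j <;> fin_cases k <;> fin_cases l <;>
    simp [Sw, Matrix.mul_apply, Fintype.sum_prod_type, Fin.sum_univ_two,
      Matrix.kroneckerMap_apply] <;> ring

theorem sw_sw : Sw * Sw = 1 := by
  ext ⟨i, j⟩ ⟨k, l⟩
  fin_cases i <;> fin_cases j <;> fin_cases k <;> fin_cases l <;>
    simp [Sw, Matrix.mul_apply, Fintype.sum_prod_type, Fin.sum_univ_two]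

theorem qm_star : Qm * Qmᴴ = (2:ℂ) • 1 := by
  ext ⟨i, j⟩ ⟨k, l⟩
  fin_cases i <;> fin_cases j <;> fin_cases k <;> fin_cases l <;>
    simp [Qm, Matrix.mul_apply, Fintype.sum_prod_type, Fin.sum_univ_two] <;> norm_num

/-- Phases in the magic basis. -/
noncomputable def lam (a b c : ℂ) : Fin 2 × Fin 2 → ℂ := fun p =>
  ![![a - b + c, -a + b + c], ![a + b - c, -a - b - c]] p.1 p.2

theorem ham_diag (a b c : ℂ) :
    (a • (σx ⊗ₖ σx) + b • (σy ⊗ₖ σy) + c • (σz ⊗ₖ σz)) * Qm = Qm * diagonal (lam a b c) := by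
  ext ⟨i, j⟩ ⟨k, l⟩
  fin_cases i <;> fin_cases j <;> fin_cases k <;> fin_cases l <;>
    simp [Qm, lam, σx, σy, σz, Matrix.mul_apply, Fintype.sum_prod_type, Fin.sum_univ_two,
      Matrix.kroneckerMap_apply, -Matrix.mul_diagonal, Matrix.diagonal_apply] <;> ring

theorem kron_unitary {A B : Matrix (Fin 2) (Fin 2) ℂ} (hA : A ∈ Matrix.unitaryGroup (Fin 2) ℂ)
    (hB : B ∈ Matrix.unitaryGroup (Fin 2) ℂ) : (Aᴴ ⊗ₖ Bᴴ) * (A ⊗ₖ B) = 1 := by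
  have h1 := Matrix.mem_unitaryGroup_iff'.mp hA
  have h2 := Matrix.mem_unitaryGroup_iff'.mp hB
  rw [Matrix.star_eq_conjTranspose] at h1 h2
  rw [← Matrix.mul_kronecker_mul, h1, h2, Matrix.one_kronecker_one]

theorem unitary_ct {A : Matrix (Fin 2) (Fin 2) ℂ} (hA : A ∈ Matrix.unitaryGroup (Fin 2) ℂ) :
    Aᴴ ∈ Matrix.unitaryGroup (Fin 2) ℂ := by
  rw [← Matrix.star_eq_conjTranspose]; exact Unitary.star_mem hA

/-- Local equivalence. -/
def Loc (U V : M4) : Prop := ∃ A B C D : Matrix (Fin 2) (Fin 2) ℂ,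
  A ∈ Matrix.unitaryGroup (Fin 2) ℂ ∧ B ∈ Matrix.unitaryGroup (Fin 2) ℂ ∧
  C ∈ Matrix.unitaryGroup (Fin 2) ℂ ∧ D ∈ Matrix.unitaryGroup (Fin 2) ℂ ∧
  U = (A ⊗ₖ B) * V * (C ⊗ₖ D)

theorem Loc.refl (U : M4) : Loc U U :=
  ⟨1, 1, 1, 1, one_mem _, one_mem _, one_mem _, one_mem _, by simp⟩

theorem Loc.trans {U V W : M4} : Loc U V → Loc V W → Loc U W := by
  rintro ⟨A, B, C, D, hA, hB, hC, hD, rfl⟩ ⟨A', B', C', D', hA', hB', hC', hD', rfl⟩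
  refine ⟨A * A', B * B', C' * C, D' * D, mul_mem hA hA', mul_mem hB hB', mul_mem hC' hC,
    mul_mem hD' hD, ?_⟩
  simp only [Matrix.mul_kronecker_mul, Matrix.mul_assoc]

theorem Loc.symm {U V : M4} : Loc U V → Loc V U := by
  rintro ⟨A, B, C, D, hA, hB, hC, hD, rfl⟩
  refine ⟨Aᴴ, Bᴴ, Cᴴ, Dᴴ, unitary_ct hA, unitary_ct hB, unitary_ct hC, unitary_ct hD, ?_⟩
  have h1 := kron_unitary hA hB
  have h2 := mul_eq_one_comm.mp (kron_unitary hC hD)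
  calc V = ((Aᴴ ⊗ₖ Bᴴ) * (A ⊗ₖ B)) * V * ((C ⊗ₖ D) * (Cᴴ ⊗ₖ Dᴴ)) := by rw [h1, h2]; simp
    _ = _ := by simp only [Matrix.mul_assoc]

noncomputable def Ham (a b c : ℝ) : M4 :=
  (a : ℂ) • (σx ⊗ₖ σx) + (b : ℂ) • (σy ⊗ₖ σy) + (c : ℂ) • (σz ⊗ₖ σz)

noncomputable def Ng (a b c : ℝ) : M4 := NormedSpace.exp (-(I / 2) • Ham a b c)

theorem loc_conj {A B : Matrix (Fin 2) (Fin 2) ℂ} (hA : A ∈ Matrix.unitaryGroup (Fin 2) ℂ)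
    (hB : B ∈ Matrix.unitaryGroup (Fin 2) ℂ) {a b c a' b' c' : ℝ}
    (h : (A ⊗ₖ B) * Ham a b c = Ham a' b' c' * (A ⊗ₖ B)) : Loc (Ng a b c) (Ng a' b' c') := by
  apply Loc.symm
  have h1 := kron_unitary hA hB
  have h2 := mul_eq_one_comm.mp h1
  have hinv : (A ⊗ₖ B)⁻¹ = Aᴴ ⊗ₖ Bᴴ := Matrix.inv_eq_left_inv h1
  have hu : IsUnit (A ⊗ₖ B) := IsUnit.of_mul_eq_one _ h2
  refine ⟨A, B, Aᴴ, Bᴴ, hA, hB, unitary_ct hA, unitary_ct hB, ?_⟩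
  rw [Ng, Ng, ← hinv, ← Matrix.exp_conj _ _ hu, hinv]
  congr 1
  rw [Matrix.mul_smul, h, Matrix.smul_mul, Matrix.mul_assoc, h2, Matrix.mul_one]

theorem qm_inv : Qm * ((1/2:ℂ) • Qmᴴ) = 1 := by
  rw [Matrix.mul_smul, qm_star, smul_smul]; norm_num

theorem qm_inv' : ((1/2:ℂ) • Qmᴴ) * Qm = 1 := mul_eq_one_comm.mp qm_inv

theorem qm_unit : IsUnit Qm := IsUnit.of_mul_eq_one _ qm_inv

theorem qm_cancel {X Y : M4} (h : X * Qm = Y * Qm) : X = Y := qm_unit.mul_right_cancel h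

theorem ng_diag (a b c : ℝ) :
    Ng a b c * Qm = Qm * diagonal (fun p => Complex.exp (-(I/2) * lam a b c p)) := by
  have hinv : Qm⁻¹ = (1/2:ℂ) • Qmᴴ := Matrix.inv_eq_left_inv qm_inv'
  have h : -(I / 2) • Ham a b c = Qm * diagonal (fun p => -(I/2) * lam a b c p) * Qm⁻¹ := by
    rw [hinv]
    apply qm_cancel
    rw [Matrix.mul_assoc _ _ Qm, qm_inv', Matrix.mul_one, Matrix.smul_mul, Ham, ham_diag,
      ← Matrix.mul_smul]
    congr 1
    ext i j
    by_cases hij : i = j <;> simp [hij]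
  rw [Ng, h, Matrix.exp_conj _ _ qm_unit, Matrix.exp_diagonal, hinv, Matrix.mul_assoc _ _ Qm, qm_inv',
    Matrix.mul_one]
  congr 2
  ext p
  rw [Pi.coe_exp, Complex.exp_eq_exp_ℂ]

theorem smul_unitary {A : Matrix (Fin 2) (Fin 2) ℂ} (hA : A ∈ Matrix.unitaryGroup (Fin 2) ℂ)
    (z : ℂ) (hz : z * star z = 1) : z • A ∈ Matrix.unitaryGroup (Fin 2) ℂ := by
  rw [Matrix.mem_unitaryGroup_iff] at *
  rw [star_smul, Matrix.smul_mul, Matrix.mul_smul, smul_smul, hA, hz, one_smul]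

theorem loc_shift (a b c : ℝ) : Loc (Ng (a + Real.pi) b c) (Ng a b c) := by
  refine ⟨(-I) • σx, σx, 1, 1, smul_unitary sx_unitary _ (by simp), sx_unitary, one_mem _,
    one_mem _, ?_⟩
  apply qm_cancel
  have hx : (σx ⊗ₖ σx) * Qm = Qm * diagonal (lam 1 0 0) := by
    simpa using ham_diag 1 0 0
  rw [Matrix.one_kronecker_one, Matrix.mul_one, Matrix.mul_assoc, ng_diag, ng_diag,
    Matrix.smul_kronecker, Matrix.smul_mul, ← Matrix.mul_assoc, hx, Matrix.mul_assoc,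
    ← Matrix.mul_smul, Matrix.diagonal_mul_diagonal, ← Matrix.diagonal_smul]
  congr 2
  have e1 : Complex.exp (-(Real.pi / 2 * I)) = -I := by
    rw [Complex.exp_neg, Complex.exp_pi_div_two_mul_I]; simp
  have e2 := Complex.exp_pi_div_two_mul_I
  ext ⟨i, j⟩
  fin_cases i <;> fin_cases j <;> simp [lam]
  · rw [show -(I / 2 * ((a:ℂ) + Real.pi - b + c)) = -(Real.pi / 2 * I) + -(I / 2 * (a - b + c)) by ring,
      Complex.exp_add, e1]; ring
  · rw [show -(I / 2 * (-(Real.pi:ℂ) + -a + b + c)) = (Real.pi / 2 * I) + -(I / 2 * (-a + b + c)) by ring,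
      Complex.exp_add, e2]
  · rw [show -(I / 2 * ((a:ℂ) + Real.pi + b - c)) = -(Real.pi / 2 * I) + -(I / 2 * (a + b - c)) by ring,
      Complex.exp_add, e1]; ring
  · rw [show -(I / 2 * (-(Real.pi:ℂ) + -a - b - c)) = (Real.pi / 2 * I) + -(I / 2 * (-a - b - c)) by ring,
      Complex.exp_add, e2]

theorem loc_shift_int (a b c : ℝ) (n : ℤ) : Loc (Ng (a + n * Real.pi) b c) (Ng a b c) := by
  induction n with
  | zero => simpa using Loc.refl _
  | succ n ih =>
    refine Loc.trans ?_ ih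
    have := loc_shift (a + n * Real.pi) b c
    convert this using 2 <;> push_cast <;> ring
  | pred n ih =>
    refine Loc.trans (Loc.symm ?_) ih
    have := loc_shift (a + ((-n - 1 : ℤ)) * Real.pi) b c
    convert this using 2
    push_cast; ring

theorem loc_flip_xy (a b c : ℝ) : Loc (Ng a b c) (Ng (-a) (-b) c) := by
  apply loc_conj sz_unitary (one_mem _)
  ext ⟨i, j⟩ ⟨k, l⟩
  fin_cases i <;> fin_cases j <;> fin_cases k <;> fin_cases l <;>
    simp [Ham, σx, σy, σz, Matrix.mul_apply, Fintype.sum_prod_type, Fin.sum_univ_two,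
      Matrix.kroneckerMap_apply] <;> ring

noncomputable def Sg : Matrix (Fin 2) (Fin 2) ℂ := !![1, 0; 0, I]
noncomputable def Hg : Matrix (Fin 2) (Fin 2) ℂ := (((√2)⁻¹ : ℝ) : ℂ) • !![1, 1; 1, -1]

theorem sg_unitary : Sg ∈ Matrix.unitaryGroup (Fin 2) ℂ := by
  rw [Matrix.mem_unitaryGroup_iff]
  ext i j
  fin_cases i <;> fin_cases j <;> simp [Sg, Matrix.mul_apply, Fin.sum_univ_two, Matrix.star_apply]

theorem hg_unitary : Hg ∈ Matrix.unitaryGroup (Fin 2) ℂ := by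
  have h : (((√2)⁻¹ : ℝ) : ℂ) * (((√2)⁻¹ : ℝ) : ℂ) = 1 / 2 := by
    rw [← Complex.ofReal_mul, ← mul_inv, Real.mul_self_sqrt (by norm_num)]; norm_num
  rw [Matrix.mem_unitaryGroup_iff]
  rw [Hg, star_smul, Matrix.smul_mul, Matrix.mul_smul, smul_smul, Complex.star_def,
    Complex.conj_ofReal, h]
  ext i j
  fin_cases i <;> fin_cases j <;>
    simp [Matrix.star_eq_conjTranspose, Matrix.vecMul, dotProduct, Fin.sum_univ_two] <;> norm_num

theorem loc_swap_xy (a b c : ℝ) : Loc (Ng a b c) (Ng b a c) := by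
  apply loc_conj sg_unitary sg_unitary
  ext ⟨i, j⟩ ⟨k, l⟩
  fin_cases i <;> fin_cases j <;> fin_cases k <;> fin_cases l <;>
    simp [Ham, Sg, σx, σy, σz, Matrix.mul_apply, Fintype.sum_prod_type, Fin.sum_univ_two,
      Matrix.kroneckerMap_apply] <;> ring

theorem loc_swap_xz (a b c : ℝ) : Loc (Ng a b c) (Ng c b a) := by
  apply loc_conj hg_unitary hg_unitary
  rw [Hg, Matrix.smul_kronecker, Matrix.kronecker_smul, Matrix.smul_mul, Matrix.smul_mul,
    Matrix.mul_smul, Matrix.mul_smul]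
  congr 2
  ext ⟨i, j⟩ ⟨k, l⟩
  fin_cases i <;> fin_cases j <;> fin_cases k <;> fin_cases l <;>
    simp [Ham, σx, σy, σz, Matrix.mul_apply, Fintype.sum_prod_type, Fin.sum_univ_two,
      Matrix.kroneckerMap_apply] <;> ring

theorem loc_swap_yz (a b c : ℝ) : Loc (Ng a b c) (Ng a c b) :=
  ((loc_swap_xy a b c).trans (loc_swap_xz b a c)).trans (loc_swap_xy c a b)

theorem loc_flip_yz (a b c : ℝ) : Loc (Ng a b c) (Ng a (-b) (-c)) :=
  ((loc_swap_xz a b c).trans (loc_flip_xy c b a)).trans (loc_swap_xz (-c) (-b) a)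

theorem loc_flip_xz (a b c : ℝ) : Loc (Ng a b c) (Ng (-a) b (-c)) :=
  ((loc_swap_xy a b c).trans (loc_flip_yz b a c)).trans (loc_swap_xy b (-a) (-c))

def Good (a b c : ℝ) : Prop := ∃ a' b' c' : ℝ, Real.pi / 2 ≥ a' ∧ a' ≥ b' ∧ b' ≥ |c'| ∧
  Loc (Ng a b c) (Ng a' b' c')

theorem Good.of_loc {a b c a' b' c' : ℝ} (h : Loc (Ng a b c) (Ng a' b' c')) :
    Good a' b' c' → Good a b c := by
  rintro ⟨x, y, z, h1, h2, h3, h4⟩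
  exact ⟨x, y, z, h1, h2, h3, h.trans h4⟩

theorem good_sorted (a b c : ℝ) (h1 : |a| ≤ Real.pi / 2) (h2 : |b| ≤ |a|) (h3 : |c| ≤ |b|) :
    Good a b c := by
  rcases le_total 0 a with ha | ha <;> rcases le_total 0 b with hb | hb
  · rw [abs_of_nonneg ha] at h1 h2
    rw [abs_of_nonneg hb] at h2 h3
    exact ⟨a, b, c, h1, h2, h3, Loc.refl _⟩
  · rw [abs_of_nonneg ha] at h1 h2
    rw [abs_of_nonpos hb] at h2 h3
    exact ⟨a, -b, -c, h1, h2, by rwa [abs_neg], loc_flip_yz _ _ _⟩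
  · rw [abs_of_nonpos ha] at h1 h2
    rw [abs_of_nonneg hb] at h2 h3
    exact ⟨-a, b, -c, h1, h2, by rwa [abs_neg], loc_flip_xz _ _ _⟩
  · rw [abs_of_nonpos ha] at h1 h2
    rw [abs_of_nonpos hb] at h2 h3
    exact ⟨-a, -b, c, h1, h2, h3, loc_flip_xy _ _ _⟩

theorem good_bdd (a b c : ℝ) (ha : |a| ≤ Real.pi / 2) (hb : |b| ≤ Real.pi / 2)
    (hc : |c| ≤ Real.pi / 2) : Good a b c := by
  rcases le_total |a| |b| with h1 | h1 <;> rcases le_total |b| |c| with h2 | h2 <;>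
    rcases le_total |a| |c| with h3 | h3
  · exact (good_sorted c b a hc h2 h1).of_loc (loc_swap_xz _ _ _)
  · exact (good_sorted c b a hc h2 h1).of_loc (loc_swap_xz _ _ _)
  · exact (good_sorted b c a hb h2 h3).of_loc ((loc_swap_xy _ _ _).trans (loc_swap_yz _ _ _))
  · exact (good_sorted b a c hb h1 h3).of_loc (loc_swap_xy _ _ _)
  · exact (good_sorted c a b hc h3 h1).of_loc ((loc_swap_xz _ _ _).trans (loc_swap_yz _ _ _))
  · exact (good_sorted a c b ha h3 h2).of_loc (loc_swap_yz _ _ _)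
  · exact (good_sorted a b c ha h1 h2)
  · exact (good_sorted a b c ha h1 h2)

theorem exists_shift (a : ℝ) : ∃ (a' : ℝ) (n : ℤ), |a'| ≤ Real.pi / 2 ∧ a = a' + n * Real.pi := by
  have hp := Real.pi_pos
  refine ⟨a - round (a / Real.pi) * Real.pi, round (a / Real.pi), ?_, by ring⟩
  have h := abs_sub_round (a / Real.pi)
  have : a - round (a / Real.pi) * Real.pi = (a / Real.pi - round (a / Real.pi)) * Real.pi := by
    field_simp
  rw [this, abs_mul, abs_of_pos hp]
  nlinarith

theorem good_all (a b c : ℝ) : Good a b c := by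
  obtain ⟨a', n, ha, rfl⟩ := exists_shift a
  obtain ⟨b', m, hb, rfl⟩ := exists_shift b
  obtain ⟨c', k, hc, rfl⟩ := exists_shift c
  refine (good_bdd a' b' c' ha hb hc).of_loc ?_
  refine (loc_shift_int _ _ _ _).trans ?_
  refine (loc_swap_xy _ _ _).trans ((loc_shift_int _ _ _ _).trans ((loc_swap_xy _ _ _).trans ?_))
  exact (loc_swap_xz _ _ _).trans ((loc_shift_int _ _ _ _).trans (loc_swap_xz _ _ _))

theorem kc_kak (V : M4) (hV : Vᴴ * V = 1) :
    ∃ (K P : Matrix (Fin 2 × Fin 2) (Fin 2 × Fin 2) ℝ) (e : Fin 2 × Fin 2 → ℂ),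
      Kᵀ * K = 1 ∧ Pᵀ * P = 1 ∧ (∀ p, ‖e p‖ = 1) ∧
      V = K.map (fun r : ℝ => (r : ℂ)) * diagonal e * P.map (fun r : ℝ => (r : ℂ)) := by
  have hV' : V * Vᴴ = 1 := mul_eq_one_comm.mp hV
  set S : M4 := Vᵀ * V with hS
  have hSt : Sᵀ = S := by simp [hS]
  have hSS : Sᴴ * S = 1 := by
    have h3 : Vᵀᴴ * Vᵀ = 1 := by
      have := congrArg Matrix.transpose hV'
      rw [Matrix.transpose_mul, Matrix.transpose_one] at this
      exact this
    rw [hS, Matrix.conjTranspose_mul]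
    calc Vᴴ * Vᵀᴴ * (Vᵀ * V) = Vᴴ * (Vᵀᴴ * Vᵀ) * V := by simp only [Matrix.mul_assoc]
      _ = 1 := by rw [h3, Matrix.mul_one, hV]
  set X : Matrix (Fin 2 × Fin 2) (Fin 2 × Fin 2) ℝ := S.map Complex.re with hX
  set Y : Matrix (Fin 2 × Fin 2) (Fin 2 × Fin 2) ℝ := S.map Complex.im with hY
  have hsym : ∀ i j, S i j = S j i := fun i j => congrFun (congrFun hSt j) i
  have hXY : X * Y = Y * X := by
    ext i j
    have := congrArg Complex.im (congrFun (congrFun hSS i) j)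
    have h0 : ((1 : M4) i j).im = 0 := by
      rw [Matrix.one_apply]; split_ifs <;> simp
    rw [h0, Matrix.mul_apply, Complex.im_sum] at this
    rw [← sub_eq_zero, Matrix.mul_apply, Matrix.mul_apply, ← Finset.sum_sub_distrib, ← this]
    refine Finset.sum_congr rfl fun k _ => ?_
    rw [Matrix.conjTranspose_apply, hsym k i]
    simp [hX, hY, Complex.mul_im]
    ring
  obtain ⟨P, x, y, hP, hXP, hYP⟩ := kc_simdiag X Y
    (by rw [hX, ← Matrix.transpose_map, hSt]) (by rw [hY, ← Matrix.transpose_map, hSt]) hXY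
  set Pc : M4 := P.map (fun r : ℝ => (r : ℂ)) with hPc
  have mapmul : ∀ A B : Matrix (Fin 2 × Fin 2) (Fin 2 × Fin 2) ℝ,
      (A * B).map (fun r : ℝ => (r : ℂ)) = A.map (fun r : ℝ => (r : ℂ)) * B.map (fun r : ℝ => (r : ℂ)) :=
    fun A B => Matrix.map_mul (f := Complex.ofRealHom)
  have mapone : (1 : Matrix (Fin 2 × Fin 2) (Fin 2 × Fin 2) ℝ).map (fun r : ℝ => (r : ℂ)) = 1 :=
    Matrix.map_one _ (by simp) (by simp)
  have hPP : Pcᵀ * Pc = 1 := by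
    rw [hPc, ← Matrix.transpose_map, ← mapmul, hP, mapone]
  have hPP' : Pc * Pcᵀ = 1 := mul_eq_one_comm.mp hPP
  have hPct : Pcᴴ = Pcᵀ := by ext i j; simp [hPc]
  have hSXY : S = X.map (fun r : ℝ => (r : ℂ)) + I • Y.map (fun r : ℝ => (r : ℂ)) := by
    ext i j
    simp [hX, hY, mul_comm I, Complex.re_add_im]
  let z : Fin 2 × Fin 2 → ℂ := fun k => x k + I * y k
  have hSP : S * Pc = Pc * diagonal z := by
    rw [hSXY, Matrix.add_mul, Matrix.smul_mul, ← mapmul, ← mapmul, hXP, hYP, mapmul, mapmul,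
      ← Matrix.mul_smul, ← Matrix.mul_add]
    congr 1
    ext i j
    by_cases h : i = j <;> simp [h, z]
  have hdz : diagonal z = Pcᵀ * S * Pc := by
    rw [Matrix.mul_assoc, hSP, ← Matrix.mul_assoc, hPP, Matrix.one_mul]
  have hdz1 : (diagonal z)ᴴ * diagonal z = 1 := by
    rw [hdz, Matrix.conjTranspose_mul, Matrix.conjTranspose_mul, ← hPct,
      Matrix.conjTranspose_conjTranspose, hPct]
    calc Pcᵀ * (Sᴴ * Pc) * (Pcᵀ * S * Pc) = Pcᵀ * (Sᴴ * (Pc * Pcᵀ) * S) * Pc := by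
          simp only [Matrix.mul_assoc]
      _ = 1 := by rw [hPP', Matrix.mul_one, hSS, Matrix.mul_one, hPP]
  have hz : ∀ k, ‖z k‖ = 1 := by
    intro k
    have := congrFun (congrFun hdz1 k) k
    rw [Matrix.diagonal_conjTranspose, Matrix.diagonal_mul_diagonal, Matrix.diagonal_apply_eq,
      Matrix.one_apply_eq, Pi.star_apply, Complex.star_def, Complex.conj_mul'] at this
    have h2 : ‖z k‖ ^ 2 = 1 := by exact_mod_cast this
    have h3 := norm_nonneg (z k)
    nlinarith
  let e : Fin 2 × Fin 2 → ℂ := fun k => Complex.exp (((z k).arg / 2 : ℝ) * I)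
  have he : ∀ k, ‖e k‖ = 1 := fun k => Complex.norm_exp_ofReal_mul_I _
  have hez : ∀ k, e k * e k = z k := by
    intro k
    have := Complex.norm_mul_exp_arg_mul_I (z k)
    rw [hz k] at this
    simp only [e]
    rw [Complex.ofReal_one, one_mul] at this
    rw [← Complex.exp_add]
    refine Eq.trans ?_ this
    congr 1
    push_cast
    ring
  have hee : ∀ k, star (e k) * e k = 1 := by
    intro k
    rw [Complex.star_def, Complex.conj_mul', he k]; simp
  have hee' : ∀ k, e k * star (e k) = 1 := fun k => by rw [mul_comm]; exact hee k
  set K : M4 := V * Pc * diagonal (star e) with hK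
  have hKt : Kᵀ * K = 1 := by
    calc Kᵀ * K = diagonal (star e) * (Pcᵀ * (Vᵀ * V) * Pc) * diagonal (star e) := by
          rw [hK]; simp only [Matrix.transpose_mul, Matrix.diagonal_transpose, Matrix.mul_assoc]
      _ = diagonal (star e) * diagonal z * diagonal (star e) := by rw [← hS, ← hdz]
      _ = 1 := by
        rw [Matrix.diagonal_mul_diagonal, Matrix.diagonal_mul_diagonal, ← Matrix.diagonal_one]
        congr 1
        ext k
        simp only [Pi.star_apply]
        rw [← hez k]
        calc star (e k) * (e k * e k) * star (e k) = (star (e k) * e k) * (e k * star (e k)) := by ring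
          _ = 1 := by rw [hee, hee', one_mul]
  have hKh : Kᴴ * K = 1 := by
    calc Kᴴ * K = diagonal e * (Pcᵀ * (Vᴴ * V) * Pc) * diagonal (star e) := by
          rw [hK]; simp only [Matrix.conjTranspose_mul, Matrix.diagonal_conjTranspose,
            Matrix.mul_assoc, star_star, hPct]
      _ = 1 := by
        rw [hV, Matrix.mul_one, hPP, Matrix.mul_one, Matrix.diagonal_mul_diagonal,
          ← Matrix.diagonal_one]
        congr 1
        ext k
        exact hee' k
  have hKeq : Kᵀ = Kᴴ := by
    have h1 := mul_eq_one_comm.mp hKh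
    calc Kᵀ = Kᵀ * (K * Kᴴ) := by rw [h1, Matrix.mul_one]
      _ = Kᴴ := by rw [← Matrix.mul_assoc, hKt, Matrix.one_mul]
  have hKr : K = (K.map Complex.re).map (fun r : ℝ => (r : ℂ)) := by
    ext i j
    have := congrFun (congrFun hKeq j) i
    rw [Matrix.transpose_apply, Matrix.conjTranspose_apply] at this
    simp only [Matrix.map_apply]
    exact (Complex.conj_eq_iff_re.mp this.symm).symm
  have mapinj : Function.Injective
      (fun A : Matrix (Fin 2 × Fin 2) (Fin 2 × Fin 2) ℝ => A.map (fun r : ℝ => (r : ℂ))) :=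
    Matrix.map_injective Complex.ofReal_injective
  refine ⟨K.map Complex.re, Pᵀ, e, ?_, ?_, he, ?_⟩
  · apply mapinj
    simp only
    rw [mapmul, Matrix.transpose_map, ← hKr, hKt, mapone]
  · rw [Matrix.transpose_transpose]; exact mul_eq_one_comm.mp hP
  · rw [← hKr, Matrix.transpose_map, ← hPc, hK]
    have : diagonal (star e) * diagonal e = (1 : M4) := by
      rw [Matrix.diagonal_mul_diagonal, ← Matrix.diagonal_one]
      congr 1
      ext k
      exact hee k
    rw [Matrix.mul_assoc (V * Pc), this, Matrix.mul_one, Matrix.mul_assoc, hPP', Matrix.mul_one]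

theorem transpose_unitary {A : Matrix (Fin 2) (Fin 2) ℂ} (hA : A ∈ Matrix.unitaryGroup (Fin 2) ℂ) :
    Aᵀ ∈ Matrix.unitaryGroup (Fin 2) ℂ := by
  rw [Matrix.mem_unitaryGroup_iff]
  have := congrArg Matrix.transpose (Matrix.mem_unitaryGroup_iff'.mp hA)
  rw [Matrix.transpose_mul, Matrix.transpose_one] at this
  exact this

theorem neg_unitary {A : Matrix (Fin 2) (Fin 2) ℂ} (hA : A ∈ Matrix.unitaryGroup (Fin 2) ℂ) :
    -A ∈ Matrix.unitaryGroup (Fin 2) ℂ := by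
  rw [Matrix.mem_unitaryGroup_iff] at *
  simpa using hA

/-- In the magic basis `M` is a local unitary. -/
def LocQ (M : M4) : Prop := ∃ A B : Matrix (Fin 2) (Fin 2) ℂ,
  A ∈ Matrix.unitaryGroup (Fin 2) ℂ ∧ B ∈ Matrix.unitaryGroup (Fin 2) ℂ ∧
  Qm * M = (A ⊗ₖ B) * Qm

/-- In the magic basis `M` is a local unitary times the swap. -/
def SwQ (M : M4) : Prop := ∃ A B : Matrix (Fin 2) (Fin 2) ℂ,
  A ∈ Matrix.unitaryGroup (Fin 2) ℂ ∧ B ∈ Matrix.unitaryGroup (Fin 2) ℂ ∧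
  Qm * M = (A ⊗ₖ B) * Sw * Qm

theorem swq_refl (u : Fin 2 × Fin 2 → ℝ) (hu : ∑ i, u i ^ 2 = 1) :
    SwQ ((1 - (2:ℝ) • Matrix.vecMulVec u u).map (fun r : ℝ => (r : ℂ))) :=
  ⟨_, _, neg_unitary (mul_mem (mu_unitary u hu) sy_unitary),
    transpose_unitary (mul_mem sy_unitary (mu_unitary u hu)), refl_local u hu⟩

theorem swq_mul_swq {M N : M4} : SwQ M → SwQ N → LocQ (M * N) := by
  rintro ⟨A, B, hA, hB, h⟩ ⟨C, D, hC, hD, h'⟩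
  refine ⟨A * D, B * C, mul_mem hA hD, mul_mem hB hC, ?_⟩
  calc Qm * (M * N) = (A ⊗ₖ B) * (Sw * (C ⊗ₖ D)) * Sw * Qm := by
        rw [← Matrix.mul_assoc, h, Matrix.mul_assoc _ Qm, h']; simp only [Matrix.mul_assoc]
    _ = (A ⊗ₖ B) * (D ⊗ₖ C) * (Sw * Sw) * Qm := by
        rw [sw_kron]; simp only [Matrix.mul_assoc]
    _ = _ := by rw [sw_sw, Matrix.mul_one, Matrix.mul_kronecker_mul]

theorem swq_mul_locq {M N : M4} : SwQ M → LocQ N → SwQ (M * N) := by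
  rintro ⟨A, B, hA, hB, h⟩ ⟨C, D, hC, hD, h'⟩
  refine ⟨A * D, B * C, mul_mem hA hD, mul_mem hB hC, ?_⟩
  calc Qm * (M * N) = (A ⊗ₖ B) * (Sw * (C ⊗ₖ D)) * Qm := by
        rw [← Matrix.mul_assoc, h, Matrix.mul_assoc _ Qm, h']; simp only [Matrix.mul_assoc]
    _ = _ := by rw [sw_kron, Matrix.mul_kronecker_mul]; simp only [Matrix.mul_assoc]

theorem orth_local (K : Matrix (Fin 2 × Fin 2) (Fin 2 × Fin 2) ℝ) (hK : Kᵀ * K = 1) :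
    LocQ (K.map (fun r : ℝ => (r : ℂ))) ∨ SwQ (K.map (fun r : ℝ => (r : ℂ))) := by
  refine kc_cartan (fun K => LocQ (K.map (fun r : ℝ => (r : ℂ))) ∨
    SwQ (K.map (fun r : ℝ => (r : ℂ)))) ?_ ?_ K hK
  · left
    refine ⟨1, 1, one_mem _, one_mem _, ?_⟩
    rw [Matrix.map_one _ (by simp) (by simp)]
    simp
  · intro u M hu hM
    have e : ((1 - (2:ℝ) • Matrix.vecMulVec u u) * M).map (fun r : ℝ => (r : ℂ)) =
        (1 - (2:ℝ) • Matrix.vecMulVec u u).map (fun r : ℝ => (r : ℂ)) *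
          M.map (fun r : ℝ => (r : ℂ)) := Matrix.map_mul (f := Complex.ofRealHom)
    simp only [e]
    rcases hM with h | h
    · exact Or.inr (swq_mul_locq (swq_refl u hu) h)
    · exact Or.inl (swq_mul_swq (swq_refl u hu) h)

/-- A sign vector. -/
def IsSgn (s : Fin 2 × Fin 2 → ℂ) : Prop := ∀ p, s p * s p = 1

theorem sgn_swq : ∃ s, IsSgn s ∧ SwQ (diagonal s) := by
  refine ⟨fun p => if p = (0,0) then -1 else 1, ?_, ?_⟩
  · intro p; by_cases h : p = (0,0) <;> simp [h]
  · have := swq_refl (fun p => if p = (0,0) then 1 else 0) (by simp)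
    convert this using 1
    ext ⟨i, j⟩ ⟨k, l⟩
    fin_cases i <;> fin_cases j <;> fin_cases k <;> fin_cases l <;>
      simp [Matrix.vecMulVec_apply, Matrix.one_apply, Matrix.diagonal_apply] <;> norm_num

theorem orth_sgn_right (K : Matrix (Fin 2 × Fin 2) (Fin 2 × Fin 2) ℝ) (hK : Kᵀ * K = 1) :
    ∃ s, IsSgn s ∧ LocQ (K.map (fun r : ℝ => (r : ℂ)) * diagonal s) := by
  rcases orth_local K hK with h | h
  · exact ⟨fun _ => 1, fun _ => by simp, by simpa using h⟩
  · obtain ⟨s, hs, hs'⟩ := sgn_swq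
    exact ⟨s, hs, swq_mul_swq h hs'⟩

theorem orth_sgn_left (K : Matrix (Fin 2 × Fin 2) (Fin 2 × Fin 2) ℝ) (hK : Kᵀ * K = 1) :
    ∃ s, IsSgn s ∧ LocQ (diagonal s * K.map (fun r : ℝ => (r : ℂ))) := by
  rcases orth_local K hK with h | h
  · exact ⟨fun _ => 1, fun _ => by simp, by simpa using h⟩
  · obtain ⟨s, hs, hs'⟩ := sgn_swq
    exact ⟨s, hs, swq_mul_swq hs' h⟩

theorem sgn_diag {s : Fin 2 × Fin 2 → ℂ} (hs : IsSgn s) : diagonal s * diagonal s = (1 : M4) := by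
  rw [Matrix.diagonal_mul_diagonal, ← Matrix.diagonal_one]
  congr 1; ext p; exact hs p

theorem sgn_norm {s : Fin 2 × Fin 2 → ℂ} (hs : IsSgn s) (p : Fin 2 × Fin 2) : ‖s p‖ = 1 := by
  have := congrArg norm (hs p)
  rw [norm_mul, norm_one] at this
  have h3 := norm_nonneg (s p)
  nlinarith

theorem diag_ng (e : Fin 2 × Fin 2 → ℂ) (he : ∀ p, ‖e p‖ = 1) :
    ∃ (z : ℂ) (a b c : ℝ), z * star z = 1 ∧ Qm * diagonal e = z • (Ng a b c * Qm) := by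
  let t : Fin 2 × Fin 2 → ℝ := fun p => (e p).arg
  have ht : ∀ p, e p = Complex.exp (t p * I) := by
    intro p
    have := Complex.norm_mul_exp_arg_mul_I (e p)
    rw [he p, Complex.ofReal_one, one_mul] at this
    exact this.symm
  let f : ℝ := (t (0,0) + t (0,1) + t (1,0) + t (1,1)) / 4
  refine ⟨Complex.exp (f * I), 2 * f - t (0,0) - t (1,0), 2 * f - t (0,1) - t (1,0),
    2 * f - t (0,0) - t (0,1), ?_, ?_⟩
  · rw [Complex.star_def, Complex.mul_conj', Complex.norm_exp_ofReal_mul_I]; simp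
  · rw [ng_diag, ← Matrix.mul_smul, ← Matrix.diagonal_smul]
    congr 2
    ext ⟨i, j⟩
    rw [ht, Pi.smul_apply, smul_eq_mul, ← Complex.exp_add]
    congr 1
    fin_cases i <;> fin_cases j <;> simp [lam, f] <;> ring

theorem loc_ng (U : M4) (hU : U ∈ Matrix.unitaryGroup (Fin 2 × Fin 2) ℂ) :
    ∃ a b c : ℝ, Loc U (Ng a b c) := by
  have hU' : Uᴴ * U = 1 := Matrix.mem_unitaryGroup_iff'.mp hU
  have hq : Qmᴴ * Qm = (2:ℂ) • (1 : M4) := by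
    have := congrArg (fun M : M4 => (2:ℂ) • M) qm_inv'
    simpa [smul_smul] using this
  set V : M4 := ((1/2:ℂ) • Qmᴴ) * U * Qm with hVdef
  have hQV : Qm * V = U * Qm := by
    rw [hVdef, ← Matrix.mul_assoc, ← Matrix.mul_assoc, qm_inv, Matrix.one_mul]
  have hV : Vᴴ * V = 1 := by
    have h1 : Vᴴ = (1/2:ℂ) • (Qmᴴ * Uᴴ * Qm) := by
      rw [hVdef]
      simp only [Matrix.conjTranspose_mul, Matrix.conjTranspose_smul,
        Matrix.conjTranspose_conjTranspose, Matrix.mul_smul, Matrix.mul_assoc]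
      simp
    rw [h1, Matrix.smul_mul, Matrix.mul_assoc, hQV]
    calc (1/2:ℂ) • (Qmᴴ * Uᴴ * (U * Qm)) = (1/2:ℂ) • (Qmᴴ * (Uᴴ * U) * Qm) := by
          simp only [Matrix.mul_assoc]
      _ = 1 := by rw [hU', Matrix.mul_one, hq, smul_smul]; norm_num
  obtain ⟨K, P, e, hK, hP, he, hVe⟩ := kc_kak V hV
  obtain ⟨s, hs, A, B, hA, hB, hAB⟩ := orth_sgn_right K hK
  obtain ⟨r, hr, C, D, hC, hD, hCD⟩ := orth_sgn_left P hP
  obtain ⟨z, a, b, c, hz, hzN⟩ := diag_ng (fun p => s p * e p * r p) (fun p => by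
    rw [norm_mul, norm_mul, sgn_norm hs, sgn_norm hr, he]; simp)
  have hmid : diagonal e = diagonal s * diagonal (fun p => s p * e p * r p) * diagonal r := by
    rw [Matrix.diagonal_mul_diagonal, Matrix.diagonal_mul_diagonal]
    congr 1; ext p
    calc e p = (s p * s p) * e p * (r p * r p) := by rw [hs, hr]; ring
      _ = _ := by ring
  refine ⟨a, b, c, z • A, B, C, D, smul_unitary hA z hz, hB, hC, hD, ?_⟩
  apply qm_cancel
  rw [← hQV, hVe, hmid]
  set Kc := K.map (fun r : ℝ => (r : ℂ))
  set Pc := P.map (fun r : ℝ => (r : ℂ))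
  calc _ = (Qm * (Kc * diagonal s)) * diagonal (fun p => s p * e p * r p) * (diagonal r * Pc) := by
        simp only [Matrix.mul_assoc]
    _ = (A ⊗ₖ B) * (Qm * diagonal (fun p => s p * e p * r p)) * (diagonal r * Pc) := by
        rw [hAB]; simp only [Matrix.mul_assoc]
    _ = z • ((A ⊗ₖ B) * Ng a b c * (Qm * (diagonal r * Pc))) := by
        rw [hzN]; simp only [Matrix.mul_assoc, Matrix.smul_mul, Matrix.mul_smul]
    _ = _ := by
        rw [hCD, Matrix.smul_kronecker]; simp only [Matrix.mul_assoc, Matrix.smul_mul]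

theorem kraus_cirac_decomposition
    (U : Matrix (Fin 2 × Fin 2) (Fin 2 × Fin 2) ℂ)
    (hU : U ∈ Matrix.unitaryGroup (Fin 2 × Fin 2) ℂ) :
    ∃ (A B C D : Matrix (Fin 2) (Fin 2) ℂ) (αx αy αz : ℝ),
      A ∈ Matrix.unitaryGroup (Fin 2) ℂ ∧
      B ∈ Matrix.unitaryGroup (Fin 2) ℂ ∧
      C ∈ Matrix.unitaryGroup (Fin 2) ℂ ∧
      D ∈ Matrix.unitaryGroup (Fin 2) ℂ ∧
      Real.pi / 2 ≥ αx ∧ αx ≥ αy ∧ αy ≥ |αz| ∧ |αz| ≥ 0 ∧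
      U = (A ⊗ₖ B) *
          NormedSpace.exp
            (-(I / 2) • ((αx : ℂ) • (σx ⊗ₖ σx) + (αy : ℂ) • (σy ⊗ₖ σy)
              + (αz : ℂ) • (σz ⊗ₖ σz))) *
          (C ⊗ₖ D) := by
  obtain ⟨a, b, c, h⟩ := loc_ng U hU
  obtain ⟨x, y, z, h1, h2, h3, h4⟩ := good_all a b c
  obtain ⟨A, B, C, D, hA, hB, hC, hD, he⟩ := h.trans h4
  exact ⟨A, B, C, D, x, y, z, hA, hB, hC, hD, h1, h2, h3, abs_nonneg _, he⟩
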